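/- arXiv:1908.03789 — 5 statements merged into one kernel-verified Lean document; each statement's English description precedes it below -/
import Mathlib

section
/- Let a, b, c, α be real numbers with a > 0, b > 0, c < 0 and α > 0. Let A = [[a/3 + 2c/3, b, 2c/3 − 2a/3], [−b/3, a, 2b/3], [c/3 − a/3, −b, 2a/3 + c/3]], B = (−a/3 − 2c/3, b/3, a/3 − c/3)ᵀ, and define f : ℝ³ → ℝ by f(x) = −α if 2x₁ − x₃ < 0, or if 2x₁ − x₃ = 0 and x₃ ≥ 0, and f(x) = α otherwise. Then there exist continuous curves φ₁, φ₂ : ℝ → ℝ³ such that for i = 1, 2 and every t ≠ 0 the curve φᵢ is differentiable at t with φᵢ′(t) = A φᵢ(t) + f(φᵢ(t)) B, and such that φ₁(t) → (−α,0,0) as t → +∞, φ₁(t) → (α,0,0) as t → −∞, φ₂(t) → (α,0,0) as t → +∞, and φ₂(t) → (−α,0,0) as t → −∞. (These two orbits form a heteroclinic loop between the two equilibria.) -/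
open Matrix Filter Topology

/-- The curve that leaves `(β, 0, 0)` along its unstable plane for `t ≤ 0` and enters `(-β, 0, 0)`
along its stable line for `t ≥ 0`. -/
noncomputable def heteroclinicOrbit (a b c β : ℝ) (t : ℝ) : Fin 3 → ℝ :=
  ![2 * (β / 3 * (2 * Real.exp (c * max t 0) - 1))
      + β / 3 * (1 - 2 * (Real.exp (a * min t 0) * Real.cos (b * min t 0))),
    2 * β / 3 * (Real.exp (a * min t 0) * Real.sin (b * min t 0)),
    β / 3 * (2 * Real.exp (c * max t 0) - 1)
      - β / 3 * (1 - 2 * (Real.exp (a * min t 0) * Real.cos (b * min t 0)))]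

theorem heteroclinicOrbit_of_nonneg (a b c β : ℝ) {t : ℝ} (ht : 0 ≤ t) :
    heteroclinicOrbit a b c β t =
      ![2 * (β / 3 * (2 * Real.exp (c * t) - 1)) - β / 3, 0,
        β / 3 * (2 * Real.exp (c * t) - 1) + β / 3] := by
  ext i
  fin_cases i <;> simp [heteroclinicOrbit, ht] <;> ring

theorem heteroclinicOrbit_of_nonpos (a b c β : ℝ) {t : ℝ} (ht : t ≤ 0) :
    heteroclinicOrbit a b c β t =
      ![β - 2 * β / 3 * (Real.exp (a * t) * Real.cos (b * t)),
        2 * β / 3 * (Real.exp (a * t) * Real.sin (b * t)),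
        2 * β / 3 * (Real.exp (a * t) * Real.cos (b * t))] := by
  ext i
  fin_cases i <;> simp [heteroclinicOrbit, ht] <;> ring

theorem continuous_heteroclinicOrbit (a b c β : ℝ) : Continuous (heteroclinicOrbit a b c β) := by
  refine continuous_pi fun i => ?_
  fin_cases i <;> simp only [heteroclinicOrbit] <;> simp <;> fun_prop

theorem tendsto_heteroclinicOrbit_atTop (a b β : ℝ) {c : ℝ} (hc : c < 0) :
    Tendsto (heteroclinicOrbit a b c β) atTop (𝓝 ![-β, 0, 0]) := by
  have hexp : Tendsto (fun t : ℝ => Real.exp (c * t)) atTop (𝓝 0) :=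
    Real.tendsto_exp_atBot.comp (tendsto_id.const_mul_atTop_of_neg hc)
  have hU : Tendsto (fun t : ℝ => β / 3 * (2 * Real.exp (c * t) - 1)) atTop
      (𝓝 (β / 3 * (2 * 0 - 1))) := ((hexp.const_mul 2).sub_const 1).const_mul _
  refine Tendsto.congr' (f₁ := fun t => ![2 * (β / 3 * (2 * Real.exp (c * t) - 1)) - β / 3, 0,
        β / 3 * (2 * Real.exp (c * t) - 1) + β / 3]) ?_ ?_
  · filter_upwards [eventually_ge_atTop 0] with t ht
    exact (heteroclinicOrbit_of_nonneg a b c β ht).symm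
  · refine tendsto_pi_nhds.2 fun i => ?_
    match i with
    | 0 =>
      change Tendsto _ _ (𝓝 (-β))
      rw [show -β = 2 * (β / 3 * (2 * 0 - 1)) - β / 3 by ring]
      exact (hU.const_mul 2).sub_const (β / 3)
    | 1 =>
      simp
    | 2 =>
      change Tendsto _ _ (𝓝 0)
      rw [show (0 : ℝ) = β / 3 * (2 * 0 - 1) + β / 3 by ring]
      exact hU.add_const (β / 3)

theorem tendsto_heteroclinicOrbit_atBot {a : ℝ} (b c β : ℝ) (ha : 0 < a) :
    Tendsto (heteroclinicOrbit a b c β) atBot (𝓝 ![β, 0, 0]) := by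
  have hexp : Tendsto (fun t : ℝ => Real.exp (a * t)) atBot (𝓝 0) :=
    Real.tendsto_exp_atBot.comp (tendsto_id.const_mul_atBot ha)
  have hmul (g : ℝ → ℝ) (hg : ∀ t, |g t| ≤ 1) :
      Tendsto (fun t : ℝ => 2 * β / 3 * (Real.exp (a * t) * g t)) atBot (𝓝 0) := by
    have h := hexp.zero_mul_isBoundedUnder_le
      (isBoundedUnder_of ⟨1, hg⟩ : IsBoundedUnder (· ≤ ·) atBot (norm ∘ g))
    simpa using h.const_mul (2 * β / 3)
  have hcos := hmul (fun t => Real.cos (b * t)) fun t => Real.abs_cos_le_one _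
  have hsin := hmul (fun t => Real.sin (b * t)) fun t => Real.abs_sin_le_one _
  refine Tendsto.congr' (f₁ := fun t => ![β - 2 * β / 3 * (Real.exp (a * t) * Real.cos (b * t)),
        2 * β / 3 * (Real.exp (a * t) * Real.sin (b * t)),
        2 * β / 3 * (Real.exp (a * t) * Real.cos (b * t))]) ?_ ?_
  · filter_upwards [eventually_le_atBot 0] with t ht
    exact (heteroclinicOrbit_of_nonpos a b c β ht).symm
  · refine tendsto_pi_nhds.2 fun i => ?_
    match i with
    | 0 =>
      simpa using hcos.const_sub β
    | 1 =>
      simpa using hsin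
    | 2 =>
      simpa using hcos

theorem heteroclinicOrbit_switching_of_pos (a b c β : ℝ) {t : ℝ} (ht : 0 < t) :
    2 * heteroclinicOrbit a b c β t 0 - heteroclinicOrbit a b c β t 2
      = 2 * β * (Real.exp (c * t) - 1) := by
  simp [heteroclinicOrbit_of_nonneg a b c β ht.le]; ring

theorem heteroclinicOrbit_switching_of_neg (a b c β : ℝ) {t : ℝ} (ht : t < 0) :
    2 * heteroclinicOrbit a b c β t 0 - heteroclinicOrbit a b c β t 2
      = 2 * β * (1 - Real.exp (a * t) * Real.cos (b * t)) := by
  simp [heteroclinicOrbit_of_nonpos a b c β ht.le]; ring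

theorem hasDerivAt_heteroclinicOrbit_of_pos (a b c β : ℝ) {t : ℝ} (ht : 0 < t) :
    HasDerivAt (heteroclinicOrbit a b c β)
      (!![a/3 + 2*c/3, b, 2*c/3 - 2*a/3;
          -b/3, a, 2*b/3;
          c/3 - a/3, -b, 2*a/3 + c/3].mulVec (heteroclinicOrbit a b c β t)
        + (-β) • ![-a/3 - 2*c/3, b/3, a/3 - c/3]) t := by
  have hexp : HasDerivAt (fun s : ℝ => Real.exp (c * s)) (Real.exp (c * t) * c) t := by
    simpa using ((hasDerivAt_id t).const_mul c).exp
  have hU := ((hexp.const_mul 2).sub_const 1).const_mul (β / 3)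
  rw [heteroclinicOrbit_of_nonneg a b c β ht.le]
  refine HasDerivAt.congr_of_eventuallyEq (f := fun s =>
    ![2 * (β / 3 * (2 * Real.exp (c * s) - 1)) - β / 3, 0,
      β / 3 * (2 * Real.exp (c * s) - 1) + β / 3]) ?_ ?_
  · refine hasDerivAt_pi.2 fun i => ?_
    match i with
    | 0 =>
      refine HasDerivAt.congr_deriv ((hU.const_mul 2).sub_const (β / 3)) ?_
      simp; ring
    | 1 =>
      refine HasDerivAt.congr_deriv (hasDerivAt_const t (0 : ℝ)) ?_
      simp; ring
    | 2 =>
      refine HasDerivAt.congr_deriv (hU.add_const (β / 3)) ?_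
      simp; ring
  · filter_upwards [lt_mem_nhds ht] with s hs
    exact heteroclinicOrbit_of_nonneg a b c β (le_of_lt hs)

theorem hasDerivAt_heteroclinicOrbit_of_neg (a b c β : ℝ) {t : ℝ} (ht : t < 0) :
    HasDerivAt (heteroclinicOrbit a b c β)
      (!![a/3 + 2*c/3, b, 2*c/3 - 2*a/3;
          -b/3, a, 2*b/3;
          c/3 - a/3, -b, 2*a/3 + c/3].mulVec (heteroclinicOrbit a b c β t)
        + β • ![-a/3 - 2*c/3, b/3, a/3 - c/3]) t := by
  have hexp : HasDerivAt (fun s : ℝ => Real.exp (a * s)) (Real.exp (a * t) * a) t := by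
    simpa using ((hasDerivAt_id t).const_mul a).exp
  have hcos : HasDerivAt (fun s : ℝ => Real.cos (b * s)) (-Real.sin (b * t) * b) t := by
    simpa using ((hasDerivAt_id t).const_mul b).cos
  have hsin : HasDerivAt (fun s : ℝ => Real.sin (b * s)) (Real.cos (b * t) * b) t := by
    simpa using ((hasDerivAt_id t).const_mul b).sin
  have hP := (hexp.mul hcos).const_mul (2 * β / 3)
  have hQ := (hexp.mul hsin).const_mul (2 * β / 3)
  rw [heteroclinicOrbit_of_nonpos a b c β ht.le]
  refine HasDerivAt.congr_of_eventuallyEq (f := fun s =>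
    ![β - 2 * β / 3 * (Real.exp (a * s) * Real.cos (b * s)),
      2 * β / 3 * (Real.exp (a * s) * Real.sin (b * s)),
      2 * β / 3 * (Real.exp (a * s) * Real.cos (b * s))]) ?_ ?_
  · refine hasDerivAt_pi.2 fun i => ?_
    match i with
    | 0 =>
      refine HasDerivAt.congr_deriv (hP.const_sub β) ?_
      simp; ring
    | 1 =>
      refine HasDerivAt.congr_deriv (hQ) ?_
      simp; ring
    | 2 =>
      refine HasDerivAt.congr_deriv (hP) ?_
      simp; ring
  · filter_upwards [gt_mem_nhds ht] with s hs
    exact heteroclinicOrbit_of_nonpos a b c β (le_of_lt hs)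

theorem exp_mul_mul_cos_lt_one {a t : ℝ} (b : ℝ) (ha : 0 < a) (ht : t < 0) :
    Real.exp (a * t) * Real.cos (b * t) < 1 := by
  have hexp : Real.exp (a * t) < 1 := Real.exp_lt_one_iff.2 (mul_neg_of_pos_of_neg ha ht)
  nlinarith [Real.exp_pos (a * t), Real.cos_le_one (b * t)]

theorem stmt_6 (a b c α : ℝ) (ha : 0 < a) (hb : 0 < b) (hc : c < 0) (hα : 0 < α)
    (A : Matrix (Fin 3) (Fin 3) ℝ)
    (hA : A = !![a/3 + 2*c/3, b, 2*c/3 - 2*a/3;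
                 -b/3, a, 2*b/3;
                 c/3 - a/3, -b, 2*a/3 + c/3])
    (B : Fin 3 → ℝ)
    (hB : B = ![-a/3 - 2*c/3, b/3, a/3 - c/3])
    (f : (Fin 3 → ℝ) → ℝ)
    (hf : ∀ x : Fin 3 → ℝ,
      f x = if 2 * x 0 - x 2 < 0 ∨ (2 * x 0 - x 2 = 0 ∧ x 2 ≥ 0) then -α else α) :
    ∃ φ₁ φ₂ : ℝ → (Fin 3 → ℝ),
      Continuous φ₁ ∧ Continuous φ₂ ∧
      (∀ t : ℝ, t ≠ 0 → HasDerivAt φ₁ (A.mulVec (φ₁ t) + f (φ₁ t) • B) t) ∧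
      (∀ t : ℝ, t ≠ 0 → HasDerivAt φ₂ (A.mulVec (φ₂ t) + f (φ₂ t) • B) t) ∧
      Tendsto φ₁ atTop (nhds ![-α, 0, 0]) ∧
      Tendsto φ₁ atBot (nhds ![α, 0, 0]) ∧
      Tendsto φ₂ atTop (nhds ![α, 0, 0]) ∧
      Tendsto φ₂ atBot (nhds ![-α, 0, 0]) := by
  subst hA hB
  have f_neg {x : Fin 3 → ℝ} (hx : 2 * x 0 - x 2 < 0) : f x = -α := by
    rw [hf, if_pos (Or.inl hx)]
  have f_pos {x : Fin 3 → ℝ} (hx : 0 < 2 * x 0 - x 2) : f x = α := by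
    rw [hf, if_neg]
    rintro (h | ⟨h, -⟩) <;> linarith
  have exp_lt {t : ℝ} (ht : 0 < t) : Real.exp (c * t) < 1 :=
    Real.exp_lt_one_iff.2 (mul_neg_of_neg_of_pos hc ht)
  refine ⟨heteroclinicOrbit a b c α, heteroclinicOrbit a b c (-α),
    continuous_heteroclinicOrbit .., continuous_heteroclinicOrbit .., fun t ht => ?_,
    fun t ht => ?_, tendsto_heteroclinicOrbit_atTop a b α hc,
    tendsto_heteroclinicOrbit_atBot b c α ha,
    by simpa using tendsto_heteroclinicOrbit_atTop a b (-α) hc,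
    tendsto_heteroclinicOrbit_atBot b c (-α) ha⟩
  · rcases ht.lt_or_gt with ht | ht
    · rw [f_pos]
      · exact hasDerivAt_heteroclinicOrbit_of_neg a b c α ht
      · rw [heteroclinicOrbit_switching_of_neg a b c α ht]
        nlinarith [exp_mul_mul_cos_lt_one b ha ht]
    · rw [f_neg]
      · exact hasDerivAt_heteroclinicOrbit_of_pos a b c α ht
      · rw [heteroclinicOrbit_switching_of_pos a b c α ht]
        nlinarith [exp_lt ht]
  · rcases ht.lt_or_gt with ht | ht
    · rw [f_neg]
      · exact hasDerivAt_heteroclinicOrbit_of_neg a b c (-α) ht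
      · rw [heteroclinicOrbit_switching_of_neg a b c (-α) ht]
        nlinarith [exp_mul_mul_cos_lt_one b ha ht]
    · rw [f_pos]
      · simpa only [neg_neg] using hasDerivAt_heteroclinicOrbit_of_pos a b c (-α) ht
      · rw [heteroclinicOrbit_switching_of_pos a b c (-α) ht]
        nlinarith [exp_lt ht]
end

section
/- Let a, b, c, α be real numbers with a > 0, b > 0, c < 0 and α > 0, let A = [[a/3 + 2c/3, b, 2c/3 − 2a/3], [−b/3, a, 2b/3], [c/3 − a/3, −b, 2a/3 + c/3]] and B = (−a/3 − 2c/3, b/3, a/3 − c/3)ᵀ. Define ψ₁ : ℝ → ℝ³ by ψ₁(t) = (−α + (4α/3)e^{ct}, 0, (2α/3)e^{ct}). Then: (i) ψ₁′(t) = A ψ₁(t) − α B for all t ∈ ℝ; (ii) ψ₁(0) = (α/3, 0, 2α/3); (iii) 2·ψ₁(t)₁ − ψ₁(t)₃ = 2α(e^{ct} − 1), which is strictly negative for t > 0 and zero at t = 0, and ψ₁(t)₃ > 0 for all t; (iv) ψ₁(t) → (−α, 0, 0) as t → +∞. -/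
open Matrix Filter Topology

theorem stmt_7 (a b c α : ℝ) (ha : 0 < a) (hb : 0 < b) (hc : c < 0) (hα : 0 < α)
    (A : Matrix (Fin 3) (Fin 3) ℝ)
    (hA : A = !![a/3 + 2*c/3, b, 2*c/3 - 2*a/3;
                 -b/3, a, 2*b/3;
                 c/3 - a/3, -b, 2*a/3 + c/3])
    (B : Fin 3 → ℝ)
    (hB : B = ![-a/3 - 2*c/3, b/3, a/3 - c/3])
    (ψ₁ : ℝ → (Fin 3 → ℝ))
    (hψ₁ : ∀ t : ℝ, ψ₁ t = ![-α + (4*α/3) * Real.exp (c*t), 0, (2*α/3) * Real.exp (c*t)]) :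
    (∀ t : ℝ, HasDerivAt ψ₁ (A.mulVec (ψ₁ t) - α • B) t) ∧
    ψ₁ 0 = ![α/3, 0, 2*α/3] ∧
    (∀ t : ℝ, 2 * ψ₁ t 0 - ψ₁ t 2 = 2 * α * (Real.exp (c*t) - 1)) ∧
    (∀ t : ℝ, 0 < t → 2 * ψ₁ t 0 - ψ₁ t 2 < 0) ∧
    (2 * ψ₁ 0 0 - ψ₁ 0 2 = 0) ∧
    (∀ t : ℝ, 0 < ψ₁ t 2) ∧
    Tendsto ψ₁ atTop (nhds ![-α, 0, 0]) := by
  obtain rfl : ψ₁ = fun t =>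
      ![-α + (4*α/3) * Real.exp (c*t), 0, (2*α/3) * Real.exp (c*t)] := funext hψ₁
  subst hA hB
  have switching_eq (t : ℝ) : 2 * (-α + (4*α/3) * Real.exp (c*t)) - (2*α/3) * Real.exp (c*t)
      = 2 * α * (Real.exp (c*t) - 1) := by ring
  refine ⟨fun t => ?_, ?_, fun t => ?_, fun t ht => ?_, ?_, fun t => ?_, ?_⟩
  · have hexp : HasDerivAt (fun s => Real.exp (c*s)) (Real.exp (c*t) * c) t := by
      simpa using ((hasDerivAt_id t).const_mul c).exp
    have hfield : !![a/3 + 2*c/3, b, 2*c/3 - 2*a/3;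
                     -b/3, a, 2*b/3;
                     c/3 - a/3, -b, 2*a/3 + c/3].mulVec
          ![-α + (4*α/3) * Real.exp (c*t), 0, (2*α/3) * Real.exp (c*t)]
          - α • ![-a/3 - 2*c/3, b/3, a/3 - c/3]
        = ![(4*α/3) * (Real.exp (c*t) * c), 0, (2*α/3) * (Real.exp (c*t) * c)] := by
      ext i
      fin_cases i <;> simp <;> ring
    rw [hfield, hasDerivAt_pi]
    intro i
    fin_cases i
    · exact (hexp.const_mul (4*α/3)).const_add (-α)
    · exact hasDerivAt_const t (0 : ℝ)
    · exact hexp.const_mul (2*α/3)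
  · ext i
    fin_cases i <;> simp
    ring
  · simpa using switching_eq t
  · have hlt : Real.exp (c*t) < 1 := Real.exp_lt_one_iff.mpr (mul_neg_of_neg_of_pos hc ht)
    have hneg : 2 * α * (Real.exp (c*t) - 1) < 0 :=
      mul_neg_of_pos_of_neg (by positivity) (by linarith)
    rw [← switching_eq] at hneg
    simpa using hneg
  · simp
    ring
  · simp only [Matrix.cons_val]
    positivity
  · have hexp : Tendsto (fun t => Real.exp (c*t)) atTop (𝓝 0) :=
      Real.tendsto_exp_atBot.comp (tendsto_id.const_mul_atTop_of_neg hc)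
    rw [tendsto_pi_nhds]
    intro i
    fin_cases i
    · simpa using (hexp.const_mul (4*α/3)).const_add (-α)
    · simp
    · simpa using hexp.const_mul (2*α/3)
end

section
/- Let a, b, c, α be real numbers with a > 0, b > 0, c < 0 and α > 0, let A = [[a/3 + 2c/3, b, 2c/3 − 2a/3], [−b/3, a, 2b/3], [c/3 − a/3, −b, 2a/3 + c/3]] and B = (−a/3 − 2c/3, b/3, a/3 − c/3)ᵀ. Define ψ₂ : ℝ → ℝ³ by ψ₂(t) = (α − (2α/3)e^{at}cos(bt), (2α/3)e^{at}sin(bt), (2α/3)e^{at}cos(bt)). Then: (i) ψ₂′(t) = A ψ₂(t) + α B for all t ∈ ℝ; (ii) ψ₂(0) = (α/3, 0, 2α/3); (iii) 2·ψ₂(t)₁ − ψ₂(t)₃ = 2α(1 − e^{at}cos(bt)), which is strictly positive for t < 0 and zero at t = 0; (iv) ψ₂(t) → (α, 0, 0) as t → −∞. -/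
open Matrix Filter Topology

theorem hasDerivAt_exp_mul_cos (a b t : ℝ) :
    HasDerivAt (fun t => Real.exp (a * t) * Real.cos (b * t))
      (a * (Real.exp (a * t) * Real.cos (b * t)) - b * (Real.exp (a * t) * Real.sin (b * t))) t := by
  have h := (((hasDerivAt_id' t).const_mul a).exp).mul (((hasDerivAt_id' t).const_mul b).cos)
  exact h.congr_deriv (by ring)

theorem hasDerivAt_exp_mul_sin (a b t : ℝ) :
    HasDerivAt (fun t => Real.exp (a * t) * Real.sin (b * t))
      (a * (Real.exp (a * t) * Real.sin (b * t)) + b * (Real.exp (a * t) * Real.cos (b * t))) t := by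
  have h := (((hasDerivAt_id' t).const_mul a).exp).mul (((hasDerivAt_id' t).const_mul b).sin)
  exact h.congr_deriv (by ring)

theorem exp_mul_cos_lt_one {x : ℝ} (hx : x < 0) (y : ℝ) : Real.exp x * Real.cos y < 1 :=
  (mul_le_of_le_one_right (Real.exp_pos x).le (Real.cos_le_one y)).trans_lt
    (Real.exp_lt_one_iff.2 hx)

theorem tendsto_exp_mul_atBot {a : ℝ} (ha : 0 < a) :
    Tendsto (fun t => Real.exp (a * t)) atBot (𝓝 0) :=
  Real.tendsto_exp_atBot.comp (tendsto_id.const_mul_atBot ha)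

theorem tendsto_exp_mul_cos_atBot {a : ℝ} (ha : 0 < a) (b : ℝ) :
    Tendsto (fun t => Real.exp (a * t) * Real.cos (b * t)) atBot (𝓝 0) :=
  squeeze_zero_norm
    (fun t => by
      rw [norm_mul, Real.norm_eq_abs, Real.norm_eq_abs, Real.abs_exp]
      exact mul_le_of_le_one_right (Real.exp_pos _).le (Real.abs_cos_le_one _))
    (tendsto_exp_mul_atBot ha)

theorem tendsto_exp_mul_sin_atBot {a : ℝ} (ha : 0 < a) (b : ℝ) :
    Tendsto (fun t => Real.exp (a * t) * Real.sin (b * t)) atBot (𝓝 0) :=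
  squeeze_zero_norm
    (fun t => by
      rw [norm_mul, Real.norm_eq_abs, Real.norm_eq_abs, Real.abs_exp]
      exact mul_le_of_le_one_right (Real.exp_pos _).le (Real.abs_sin_le_one _))
    (tendsto_exp_mul_atBot ha)

theorem stmt_8 (a b c α : ℝ) (ha : 0 < a) (hb : 0 < b) (hc : c < 0) (hα : 0 < α)
    (A : Matrix (Fin 3) (Fin 3) ℝ)
    (hA : A = !![a/3 + 2*c/3, b, 2*c/3 - 2*a/3;
                 -b/3, a, 2*b/3;
                 c/3 - a/3, -b, 2*a/3 + c/3])
    (B : Fin 3 → ℝ)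
    (hB : B = ![-a/3 - 2*c/3, b/3, a/3 - c/3])
    (ψ₂ : ℝ → (Fin 3 → ℝ))
    (hψ₂ : ∀ t : ℝ, ψ₂ t =
      ![α - (2*α/3) * Real.exp (a*t) * Real.cos (b*t),
        (2*α/3) * Real.exp (a*t) * Real.sin (b*t),
        (2*α/3) * Real.exp (a*t) * Real.cos (b*t)]) :
    (∀ t : ℝ, HasDerivAt ψ₂ (A.mulVec (ψ₂ t) + α • B) t) ∧
    ψ₂ 0 = ![α/3, 0, 2*α/3] ∧
    (∀ t : ℝ, 2 * ψ₂ t 0 - ψ₂ t 2 = 2 * α * (1 - Real.exp (a*t) * Real.cos (b*t))) ∧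
    (∀ t : ℝ, t < 0 → 0 < 2 * ψ₂ t 0 - ψ₂ t 2) ∧
    (2 * ψ₂ 0 0 - ψ₂ 0 2 = 0) ∧
    Tendsto ψ₂ atBot (nhds ![α, 0, 0]) := by
  have hsurf : ∀ t : ℝ, 2 * ψ₂ t 0 - ψ₂ t 2
      = 2 * α * (1 - Real.exp (a*t) * Real.cos (b*t)) := by
    intro t
    simp only [hψ₂, Matrix.cons_val]
    ring
  refine ⟨fun t => ?_, ?_, hsurf, fun t ht => ?_, ?_, ?_⟩
  · have hcos := (hasDerivAt_exp_mul_cos a b t).const_mul (2*α/3)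
    have hsin := (hasDerivAt_exp_mul_sin a b t).const_mul (2*α/3)
    rw [hψ₂ t, funext hψ₂, hasDerivAt_pi]
    simp only [mul_assoc (2*α/3)]
    intro i
    fin_cases i
    · refine (hcos.const_sub α).congr_deriv ?_
      simp [hA, hB]
      ring
    · refine hsin.congr_deriv ?_
      simp [hA, hB]
      ring
    · refine hcos.congr_deriv ?_
      simp [hA, hB]
      ring
  · simp only [hψ₂, mul_zero, Real.exp_zero, Real.cos_zero, Real.sin_zero, mul_one]
    congr 1
    ring
  · rw [hsurf]
    have := exp_mul_cos_lt_one (mul_neg_of_pos_of_neg ha ht) (b*t)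
    exact mul_pos (by positivity) (sub_pos.2 this)
  · simp [hsurf]
  · have hcos := (tendsto_exp_mul_cos_atBot ha b).const_mul (2*α/3)
    have hsin := (tendsto_exp_mul_sin_atBot ha b).const_mul (2*α/3)
    rw [mul_zero] at hcos hsin
    rw [funext hψ₂, tendsto_pi_nhds]
    simp only [mul_assoc (2*α/3)]
    intro i
    fin_cases i
    · simpa using hcos.const_sub α
    · exact hsin
    · exact hcos
end

section
/- Let a and b be real numbers with a > 0 and b > 0, let τ = (arctan(b/a) + π/2)/b, and let g(t) = e^{−at}·cos(bt). Then g(τ) = −(b/√(a² + b²))·e^{−aτ}, and g(t) ≥ g(τ) for every t ≥ 0, with equality only at t = τ. -/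
theorem cos_add_mul_sin_lt_exp {c s : ℝ} (hc : 0 < c) (hs : -Real.pi < s) (hs0 : s ≠ 0) :
    Real.cos s + c * Real.sin s < Real.exp (c * s) := by
  rcases lt_or_gt_of_ne hs0 with hneg | hpos
  · have hsin : Real.sin s < 0 := Real.sin_neg_of_neg_of_neg_pi_lt hneg hs
    have hcsin : c * Real.sin s < 0 := mul_neg_of_pos_of_neg hc hsin
    have hexp : 0 < Real.exp (c * s) := Real.exp_pos _
    rcases le_or_gt s (-(Real.pi / 2)) with h | h
    · have hcos : Real.cos s ≤ 0 := by
        rw [← Real.cos_neg]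
        exact Real.cos_nonpos_of_pi_div_two_le_of_le (by linarith) (by linarith)
      linarith
    · have hcos : 0 < Real.cos s := Real.cos_pos_of_mem_Ioo ⟨by linarith, by linarith⟩
      have htan : -s < Real.tan (-s) := Real.lt_tan (by linarith) (by linarith)
      rw [Real.tan_neg, Real.tan_eq_sin_div_cos, neg_lt_neg_iff, div_lt_iff₀ hcos] at htan
      calc Real.cos s + c * Real.sin s < Real.cos s + c * (s * Real.cos s) := by gcongr
        _ = Real.cos s * (c * s + 1) := by ring
        _ ≤ Real.cos s * Real.exp (c * s) := by
          gcongr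
          exact Real.add_one_le_exp _
        _ ≤ 1 * Real.exp (c * s) := by
          gcongr
          exact Real.cos_le_one s
        _ = Real.exp (c * s) := one_mul _
  · calc Real.cos s + c * Real.sin s < 1 + c * s :=
        add_lt_add_of_le_of_lt (Real.cos_le_one s)
          (mul_lt_mul_of_pos_left (Real.sin_lt hpos) hc)
      _ ≤ Real.exp (c * s) := by linarith [Real.add_one_le_exp (c * s)]

theorem sin_arctan_div {a b : ℝ} (ha : 0 < a) :
    Real.sin (Real.arctan (b / a)) = b / Real.sqrt (a ^ 2 + b ^ 2) := by
  have h : Real.sqrt (a ^ 2 + b ^ 2) = a * Real.sqrt (1 + (b / a) ^ 2) := by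
    rw [show a ^ 2 + b ^ 2 = a ^ 2 * (1 + (b / a) ^ 2) by field_simp,
      Real.sqrt_mul (sq_nonneg a), Real.sqrt_sq ha.le]
  rw [Real.sin_arctan, h, div_div]

theorem stmt_15 (a b : ℝ) (ha : 0 < a) (hb : 0 < b)
    (τ : ℝ) (hτ : τ = (Real.arctan (b/a) + Real.pi/2) / b)
    (g : ℝ → ℝ) (hg : ∀ t : ℝ, g t = Real.exp (-(a*t)) * Real.cos (b*t)) :
    g τ = -(b / Real.sqrt (a^2 + b^2)) * Real.exp (-(a*τ)) ∧
    (∀ t : ℝ, 0 ≤ t → g τ ≤ g t) ∧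
    (∀ t : ℝ, 0 ≤ t → g t = g τ → t = τ) := by
  set θ := Real.arctan (b / a) with hθ
  have hbτ : b * τ = θ + Real.pi / 2 := by rw [hτ]; field_simp
  have hsin : 0 < Real.sin θ := by
    rw [hθ, sin_arctan_div ha]
    positivity
  have hcos : Real.cos θ = a / b * Real.sin θ := by
    have h := Real.tan_arctan (b / a)
    rw [← hθ, Real.tan_eq_sin_div_cos, div_eq_div_iff (Real.cos_arctan_pos _).ne' ha.ne'] at h
    field_simp
    linarith
  have hgτ : g τ = -Real.sin θ * Real.exp (-(a * τ)) := by
    rw [hg, hbτ, Real.cos_add_pi_div_two]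
    ring
  have hlt : ∀ t : ℝ, 0 ≤ t → t ≠ τ → g τ < g t := by
    intro t ht hne
    have hs : -Real.pi < b * (t - τ) := by
      nlinarith [Real.arctan_lt_pi_div_two (b / a), mul_nonneg hb.le ht]
    have key := cos_add_mul_sin_lt_exp (div_pos ha hb) hs
      (mul_ne_zero hb.ne' (sub_ne_zero.mpr hne))
    have hexp : Real.exp (-(a * τ)) = Real.exp (-(a * t)) * Real.exp (a / b * (b * (t - τ))) := by
      rw [← Real.exp_add]
      congr 1
      field_simp
      ring
    have hcost : Real.cos (b * t) =
        -(Real.sin θ * (Real.cos (b * (t - τ)) + a / b * Real.sin (b * (t - τ)))) := by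
      rw [show b * t = θ + b * (t - τ) + Real.pi / 2 by linear_combination hbτ,
        Real.cos_add_pi_div_two, Real.sin_add, hcos]
      ring
    have h := mul_lt_mul_of_pos_left key (mul_pos (Real.exp_pos (-(a * t))) hsin)
    rw [hgτ, hg t, hexp, hcost]
    linarith
  refine ⟨?_, fun t ht => ?_, fun t ht h => ?_⟩
  · rw [hgτ, hθ, sin_arctan_div ha]
  · rcases eq_or_ne t τ with rfl | hne
    · exact le_rfl
    · exact (hlt t ht hne).le
  · by_contra hne
    exact (hlt t ht hne).ne' h
end

section
/- Let a and b be real numbers with a > 0 and b > 0, let τ = (arctan(b/a) + π/2)/b, and set m = e^{−aτ}·cos(bτ). Then −1 < m < 0, and for every real α > 0 one has α(1 − m) < α(m − 1)/m. Consequently the open interval Γ = ( α(1 − e^{−aτ}cos(bτ)), α(e^{−aτ}cos(bτ) − 1)/(e^{−aτ}cos(bτ)) ) appearing in Proposition 3 is nonempty. -/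
theorem stmt_16 (a b : ℝ) (ha : 0 < a) (hb : 0 < b)
    (τ : ℝ) (hτ : τ = (Real.arctan (b/a) + Real.pi/2) / b)
    (m : ℝ) (hm : m = Real.exp (-(a*τ)) * Real.cos (b*τ)) :
    (-1 < m ∧ m < 0) ∧
    ∀ α : ℝ, 0 < α →
      α * (1 - m) < α * (m - 1) / m ∧
      (Set.Ioo (α * (1 - m)) (α * (m - 1) / m)).Nonempty := by
  have hθ : 0 < Real.arctan (b / a) := Real.arctan_pos.2 (div_pos hb ha)
  have hθ' : Real.arctan (b / a) < Real.pi / 2 := Real.arctan_lt_pi_div_two _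
  have hτ_pos : 0 < τ := by
    rw [hτ]
    have := Real.pi_pos
    positivity
  have hbτ : b * τ = Real.arctan (b / a) + Real.pi / 2 := by
    rw [hτ]
    field_simp
  rw [hbτ, Real.cos_add_pi_div_two] at hm
  have hsin : 0 < Real.sin (Real.arctan (b / a)) :=
    Real.sin_pos_of_pos_of_lt_pi hθ (by linarith)
  have hsin' : Real.sin (Real.arctan (b / a)) ≤ 1 := Real.sin_le_one _
  have hexp : 0 < Real.exp (-(a * τ)) := Real.exp_pos _
  have hexp' : Real.exp (-(a * τ)) < 1 := Real.exp_lt_one_iff.2 (neg_lt_zero.2 (mul_pos ha hτ_pos))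
  have hm_neg : m < 0 := by
    rw [hm]
    nlinarith [mul_pos hexp hsin]
  have hm_gt : -1 < m := by
    rw [hm]
    nlinarith
  refine ⟨⟨hm_gt, hm_neg⟩, fun α hα ↦ ?_⟩
  have hlt : α * (1 - m) < α * (m - 1) / m := by
    rw [lt_div_iff_of_neg hm_neg]
    nlinarith [mul_pos hα (mul_pos (show 0 < 1 - m by linarith) (show 0 < 1 + m by linarith))]
  exact ⟨hlt, Set.nonempty_Ioo.2 hlt⟩
end
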